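/- Lemma 1: for the (2^{nR1}, 2^{nR2}, n; p) random code ensemble used over the 2-DM-IC, lim_{n→∞} (1/n) H(Y1^n | X1^n, C_n) = H(Y1 | X1, X2, Q) + min{ R2, I(X2; Y1 | X1, Q) }, where C_n denotes the random codebook (Q^n together with all codewords X1^n(m1), m1 ∈ [2^{nR1}], and X2^n(m2), m2 ∈ [2^{nR2}]), X1^n = X1^n(M1) is the transmitted codeword of sender 1, and Y1^n is the channel output at receiver 1. -/

import Mathlib

open scoped BigOperators
open Filter

set_option synthInstance.maxSize 4000
set_option synthInstance.maxHeartbeats 1000000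
set_option maxHeartbeats 1000000

noncomputable section

/-- Shannon entropy (base 2) of a finitely supported distribution `p`. -/
def ent {α : Type*} [Fintype α] (p : α → ℝ) : ℝ := -∑ a, p a * Real.logb 2 (p a)

/-- The distribution (pushforward) of a random variable `f` on the finite
probability space `(Ω, p)`. -/
def distOf {Ω β : Type*} [Fintype Ω] [DecidableEq β] (p : Ω → ℝ) (f : Ω → β) : β → ℝ :=
  fun b => ∑ ω, if f ω = b then p ω else 0

/-- The entropy `H(f)` of a random variable `f` on the finite probability space `(Ω, p)`. -/
def entOf {Ω β : Type*} [Fintype Ω] [Fintype β] [DecidableEq β] (p : Ω → ℝ) (f : Ω → β) : ℝ :=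
  ent (distOf p f)

/-- The conditional entropy `H(f | g)`. -/
def condEnt {Ω β γ : Type*} [Fintype Ω] [Fintype β] [Fintype γ] [DecidableEq β] [DecidableEq γ]
    (p : Ω → ℝ) (f : Ω → β) (g : Ω → γ) : ℝ :=
  entOf p (fun ω => (f ω, g ω)) - entOf p g

/-- The mutual information `I(f; g)`. -/
def mutInfo {Ω β γ : Type*} [Fintype Ω] [Fintype β] [Fintype γ] [DecidableEq β] [DecidableEq γ]
    (p : Ω → ℝ) (f : Ω → β) (g : Ω → γ) : ℝ :=
  entOf p f + entOf p g - entOf p (fun ω => (f ω, g ω))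

/-- The conditional mutual information `I(f; g | h)`. -/
def condMutInfo {Ω β γ δ : Type*} [Fintype Ω] [Fintype β] [Fintype γ] [Fintype δ]
    [DecidableEq β] [DecidableEq γ] [DecidableEq δ]
    (p : Ω → ℝ) (f : Ω → β) (g : Ω → γ) (h : Ω → δ) : ℝ :=
  entOf p (fun ω => (f ω, h ω)) + entOf p (fun ω => (g ω, h ω)) -
    entOf p (fun ω => (f ω, g ω, h ω)) - entOf p h

/-- `p` is a probability mass function on the finite alphabet `α`. -/
def IsPMF {α : Type*} [Fintype α] (p : α → ℝ) : Prop := (∀ a, 0 ≤ p a) ∧ ∑ a, p a = 1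

/-- The number `2^{nR}` of messages at blocklength `n` and rate `R` (in bits). -/
def msgSize (n : ℕ) (R : ℝ) : ℕ := max 1 ⌊(2 : ℝ) ^ ((n : ℝ) * R)⌋₊

instance (n : ℕ) (R : ℝ) : NeZero (msgSize n R) :=
  ⟨by have h : 1 ≤ msgSize n R := le_max_left _ _; omega⟩

/-- The `ε`-typical set: `xs` is `ε`-typical for the pmf `p` if the empirical frequency of
every symbol `a` is within `ε · p a` of `p a`. -/
def Typical {α : Type*} [Fintype α] [DecidableEq α] (p : α → ℝ) (ε : ℝ) {n : ℕ}
    (xs : Fin n → α) : Prop :=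
  ∀ a, |((Finset.univ.filter fun i => xs i = a).card : ℝ) / (n : ℝ) - p a| ≤ ε * p a

section TwoUser

variable {Q X1 X2 Y1 Y2 : Type*} [Fintype Q] [DecidableEq Q] [Fintype X1] [DecidableEq X1]
  [Fintype X2] [DecidableEq X2] [Fintype Y1] [DecidableEq Y1] [Fintype Y2] [DecidableEq Y2]

variable (pQ : Q → ℝ) (pX1 : Q → X1 → ℝ) (pX2 : Q → X2 → ℝ) (W : X1 → X2 → Y1 × Y2 → ℝ)

/-- The single-letter joint distribution of `(Q, X1, X2, Y1, Y2)` induced by the input pmf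
`p(q) p(x1|q) p(x2|q)` and the channel `p(y1, y2 | x1, x2)`. -/
def jointP : Q × X1 × X2 × Y1 × Y2 → ℝ := fun z =>
  pQ z.1 * pX1 z.1 z.2.1 * pX2 z.1 z.2.2.1 * W z.2.1 z.2.2.1 (z.2.2.2.1, z.2.2.2.2)

def vQ : Q × X1 × X2 × Y1 × Y2 → Q := fun z => z.1
def vX1 : Q × X1 × X2 × Y1 × Y2 → X1 := fun z => z.2.1
def vX2 : Q × X1 × X2 × Y1 × Y2 → X2 := fun z => z.2.2.1
def vY1 : Q × X1 × X2 × Y1 × Y2 → Y1 := fun z => z.2.2.2.1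
def vY2 : Q × X1 × X2 × Y1 × Y2 → Y2 := fun z => z.2.2.2.2

/-- The rate region `𝓡₁(p)` for receiver 1: either `R1 ≤ I(X1; Y1 | Q)`, or both
`R2 ≤ I(X2; Y1 | X1, Q)` and `R1 + R2 ≤ I(X1, X2; Y1 | Q)`. -/
def Region1 : Set (ℝ × ℝ) :=
  {r | 0 ≤ r.1 ∧ 0 ≤ r.2 ∧
    (r.1 ≤ condMutInfo (jointP pQ pX1 pX2 W) vX1 vY1 vQ ∨
      (r.2 ≤ condMutInfo (jointP pQ pX1 pX2 W) vX2 vY1 (fun z => (vX1 z, vQ z)) ∧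
        r.1 + r.2 ≤ condMutInfo (jointP pQ pX1 pX2 W) (fun z => (vX1 z, vX2 z)) vY1 vQ))}

/-- The rate region `𝓡₂(p)` for receiver 2, obtained from `𝓡₁(p)` by exchanging
the roles of the two users. -/
def Region2 : Set (ℝ × ℝ) :=
  {r | 0 ≤ r.1 ∧ 0 ≤ r.2 ∧
    (r.2 ≤ condMutInfo (jointP pQ pX1 pX2 W) vX2 vY2 vQ ∨
      (r.1 ≤ condMutInfo (jointP pQ pX1 pX2 W) vX1 vY2 (fun z => (vX2 z, vQ z)) ∧
        r.1 + r.2 ≤ condMutInfo (jointP pQ pX1 pX2 W) (fun z => (vX1 z, vX2 z)) vY2 vQ))}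

/-- A codebook for the two-user interference channel: a time-sharing sequence together with
a codeword for each message of each sender. -/
abbrev Codebook (Q X1 X2 : Type*) (n M1 M2 : ℕ) : Type _ :=
  (Fin n → Q) × (Fin M1 → Fin n → X1) × (Fin M2 → Fin n → X2)

/-- The probability of a codebook under the `p`-distributed random code ensemble. -/
def ensembleP {n M1 M2 : ℕ} (c : Codebook Q X1 X2 n M1 M2) : ℝ :=
  (∏ i, pQ (c.1 i)) * (∏ m1, ∏ i, pX1 (c.1 i) (c.2.1 m1 i)) *
    (∏ m2, ∏ i, pX2 (c.1 i) (c.2.2 m2 i))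

/-- The average probability of error of the code given by codebook `c` and decoders
`d1`, `d2` (messages are uniform, the channel is memoryless). -/
def PeCode {n M1 M2 : ℕ} (c : Codebook Q X1 X2 n M1 M2)
    (d1 : (Fin n → Y1) → Fin M1) (d2 : (Fin n → Y2) → Fin M2) : ℝ :=
  ((M1 : ℝ) * (M2 : ℝ))⁻¹ * ∑ m1, ∑ m2, ∑ y1 : Fin n → Y1, ∑ y2 : Fin n → Y2,
    (∏ i, W (c.2.1 m1 i) (c.2.2 m2 i) (y1 i, y2 i)) *
      (if d1 y1 = m1 ∧ d2 y2 = m2 then 0 else 1)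

/-- The probability of error of the codebook `c` under optimal (maximum likelihood)
decoding, i.e. the least error probability over all decoder pairs. -/
def PeOpt {n M1 M2 : ℕ} (c : Codebook Q X1 X2 n M1 M2) : ℝ :=
  ⨅ d : ((Fin n → Y1) → Fin M1) × ((Fin n → Y2) → Fin M2), PeCode W c d.1 d.2

/-- The probability of error under optimal decoding at blocklength `n` and rates `(R1, R2)`,
averaged over the random code ensemble. -/
def avgPeOpt (R1 R2 : ℝ) (n : ℕ) : ℝ :=
  ∑ c : Codebook Q X1 X2 n (msgSize n R1) (msgSize n R2),
    ensembleP pQ pX1 pX2 c * PeOpt W c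

/-- The sample space of the full communication experiment: a random codebook, a uniform
message pair, and the channel output sequences. -/
abbrev ExpSpace (Q X1 X2 Y1 Y2 : Type*) (n M1 M2 : ℕ) : Type _ :=
  Codebook Q X1 X2 n M1 M2 × Fin M1 × Fin M2 × (Fin n → Y1) × (Fin n → Y2)

/-- The joint distribution of the communication experiment: the codebook is drawn from the
random code ensemble, the messages `(M1, M2)` are independent and uniform, and the output
sequences are produced by the memoryless channel from the transmitted codewords. -/
def expP {n M1 M2 : ℕ} : ExpSpace Q X1 X2 Y1 Y2 n M1 M2 → ℝ := fun ω =>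
  ensembleP pQ pX1 pX2 ω.1 * ((M1 : ℝ) * (M2 : ℝ))⁻¹ *
    ∏ i, W (ω.1.2.1 ω.2.1 i) (ω.1.2.2 ω.2.2.1 i) (ω.2.2.2.1 i, ω.2.2.2.2 i)

theorem sum_prod_pi {ι α : Type*} [Fintype ι] [DecidableEq ι] [Fintype α] (f : ι → α → ℝ) :
    ∑ c : ι → α, ∏ i, f i (c i) = ∏ i, ∑ a, f i a := by
  rw [Finset.prod_univ_sum, Fintype.piFinset_univ]

theorem isPMF_pi {ι α : Type*} [Fintype ι] [DecidableEq ι] [Fintype α] {p : ι → α → ℝ}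
    (hp : ∀ i, IsPMF (p i)) : IsPMF (fun c : ι → α => ∏ i, p i (c i)) :=
  ⟨fun c => Finset.prod_nonneg fun i _ => (hp i).1 (c i), by
    rw [sum_prod_pi]; exact Finset.prod_eq_one fun i _ => (hp i).2⟩

/-- Under a product distribution, functions of two distinct coordinates are independent. -/
theorem sum_pi_mul_eval_mul_eval {ι α : Type*} [Fintype ι] [DecidableEq ι] [Fintype α]
    {p : ι → α → ℝ} (hp : ∀ i, IsPMF (p i)) {i j : ι} (hij : i ≠ j) (F G : α → ℝ) :
    ∑ c : ι → α, (∏ k, p k (c k)) * (F (c i) * G (c j)) =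
      (∑ a, p i a * F a) * ∑ a, p j a * G a := by
  have h1 : ∀ c : ι → α, (∏ k, p k (c k)) * (F (c i) * G (c j)) =
      ∏ k, p k (c k) * ((if k = i then F (c k) else 1) * (if k = j then G (c k) else 1)) := by
    intro c
    simp only [Finset.prod_mul_distrib]
    simp
  have h2 : ∀ k, ∑ a, p k a * ((if k = i then F a else 1) * (if k = j then G a else 1)) =
      (if k = i then ∑ a, p i a * F a else 1) * (if k = j then ∑ a, p j a * G a else 1) := by
    intro k
    by_cases hi : k = i
    · subst hi; simp [hij]
    · by_cases hj : k = j
      · subst hj; simp [hi]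
      · simp [hi, hj, (hp k).2]
  simp_rw [h1]
  rw [sum_prod_pi (fun k a => p k a * ((if k = i then F a else 1) * (if k = j then G a else 1)))]
  simp_rw [h2, Finset.prod_mul_distrib]
  simp

/-- The coordinate marginals of a product distribution are its factors. -/
theorem sum_pi_mul_eval {ι α : Type*} [Fintype ι] [DecidableEq ι] [Fintype α]
    {p : ι → α → ℝ} (hp : ∀ i, IsPMF (p i)) (i : ι) (F : α → ℝ) :
    ∑ c : ι → α, (∏ k, p k (c k)) * F (c i) = ∑ a, p i a * F a := by
  have h1 : ∀ c : ι → α, (∏ k, p k (c k)) * F (c i) =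
      ∏ k, p k (c k) * (if k = i then F (c k) else 1) := by
    intro c
    simp only [Finset.prod_mul_distrib]
    simp
  have h2 : ∀ k, ∑ a, p k a * (if k = i then F a else 1) =
      (if k = i then ∑ a, p i a * F a else 1) := by
    intro k
    by_cases hi : k = i
    · subst hi; simp
    · simp [hi, (hp k).2]
  simp_rw [h1]
  rw [sum_prod_pi (fun k a => p k a * (if k = i then F a else 1))]
  simp_rw [h2]
  simp

theorem sum_pi_mul_sum {α : Type*} [Fintype α] {r : α → ℝ} (hr : IsPMF r) (n : ℕ) (f : α → ℝ) :
    ∑ z : Fin n → α, (∏ i, r (z i)) * ∑ i, f (z i) = n * ∑ a, r a * f a := by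
  simp_rw [Finset.mul_sum]
  rw [Finset.sum_comm]
  simp_rw [sum_pi_mul_eval (fun _ : Fin n => hr)]
  simp [Finset.mul_sum]

/-- The variance of a sum of i.i.d. centered variables. -/
theorem sum_pi_mul_sum_sq {α : Type*} [Fintype α] {r : α → ℝ} (hr : IsPMF r) (n : ℕ)
    {g : α → ℝ} (hg : ∑ a, r a * g a = 0) :
    ∑ z : Fin n → α, (∏ i, r (z i)) * (∑ i, g (z i)) ^ 2 = n * ∑ a, r a * g a ^ 2 := by
  have h : ∀ i j : Fin n, ∑ z : Fin n → α, (∏ k, r (z k)) * (g (z i) * g (z j)) =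
      if i = j then ∑ a, r a * g a ^ 2 else 0 := by
    intro i j
    by_cases hij : i = j
    · subst hij
      rw [if_pos rfl, ← sum_pi_mul_eval (fun _ : Fin n => hr) i (fun a => g a ^ 2)]
      simp_rw [sq]
    · rw [if_neg hij, sum_pi_mul_eval_mul_eval (fun _ : Fin n => hr) hij, hg, zero_mul]
  simp_rw [sq (∑ i, g _), Finset.sum_mul_sum, Finset.mul_sum]
  rw [Finset.sum_comm]
  simp_rw [Finset.sum_comm (s := (Finset.univ : Finset (Fin n → α))), h]
  simp [Finset.mul_sum]

/-- A quantitative mean ergodic bound for i.i.d. sums. -/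
theorem sum_pi_mul_abs_sub_le {α : Type*} [Fintype α] {r : α → ℝ} (hr : IsPMF r) {n : ℕ}
    (hn : 0 < n) (f : α → ℝ) :
    ∑ z : Fin n → α, (∏ i, r (z i)) * |∑ i, f (z i) - n * ∑ a, r a * f a| ≤
      √n * ((∑ a, r a * (f a - ∑ b, r b * f b) ^ 2 + 1) / 2) := by
  set μ := ∑ a, r a * f a with hμ
  have hs : 0 < √(n : ℝ) := Real.sqrt_pos.2 (by exact_mod_cast hn)
  have hss : √(n : ℝ) * √(n : ℝ) = n := Real.mul_self_sqrt (Nat.cast_nonneg n)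
  have hg : ∑ a, r a * (f a - μ) = 0 := by
    simp_rw [mul_sub, Finset.sum_sub_distrib, ← Finset.sum_mul, hr.2, one_mul]
    exact sub_self _
  have hsq := sum_pi_mul_sum_sq hr n hg
  have hone := (isPMF_pi (fun _ : Fin n => hr)).2
  have habs : ∀ t : ℝ, |t| ≤ t ^ 2 * (2 * √(n : ℝ))⁻¹ + √n / 2 := by
    intro t
    have h : 0 ≤ (|t| - √n) ^ 2 * (2 * √(n : ℝ))⁻¹ := by positivity
    have h' : (|t| - √n) ^ 2 * (2 * √(n : ℝ))⁻¹ = t ^ 2 * (2 * √(n : ℝ))⁻¹ + √n / 2 - |t| := by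
      rw [sub_sq, sq_abs]; field_simp; ring
    linarith
  calc _ ≤ ∑ z : Fin n → α, (∏ i, r (z i)) *
        ((∑ i, (f (z i) - μ)) ^ 2 * (2 * √(n : ℝ))⁻¹ + √n / 2) := by
        refine Finset.sum_le_sum fun z _ => mul_le_mul_of_nonneg_left ?_
          (Finset.prod_nonneg fun i _ => hr.1 _)
        have : ∑ i, f (z i) - n * μ = ∑ i, (f (z i) - μ) := by simp
        rw [this]
        exact habs _
    _ = (n * ∑ a, r a * (f a - μ) ^ 2) * (2 * √(n : ℝ))⁻¹ + √n / 2 := by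
        simp_rw [mul_add, Finset.sum_add_distrib, ← mul_assoc, ← Finset.sum_mul, hone, one_mul, hsq]
    _ = _ := by
        nth_rewrite 1 [← hss]
        field_simp

theorem sum_pi_prod {ι α β : Type*} [Fintype ι] [DecidableEq ι] [Fintype α] [Fintype β]
    (F : (ι → α × β) → ℝ) :
    ∑ z, F z = ∑ a : ι → α, ∑ b : ι → β, F (fun i => (a i, b i)) := by
  rw [← Fintype.sum_prod_type']
  exact Fintype.sum_equiv (Equiv.arrowProdEquivProdArrow ι (fun _ => α) (fun _ => β)) _ _
    (fun z => rfl)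

theorem ent_eq_sum_negMulLog {α : Type*} [Fintype α] (p : α → ℝ) :
    ent p = (∑ a, Real.negMulLog (p a)) / Real.log 2 := by
  simp [ent, Real.negMulLog, Real.logb, Finset.sum_div, mul_div_assoc, neg_div]

/-- The chain rule: if `f` given `g` has conditional law `K`, then `H(f | g)` is the average
of the entropies of `K`. -/
theorem condEnt_eq_of_kernel {Ω β γ : Type*} [Fintype Ω] [Fintype β] [Fintype γ] [DecidableEq β]
    [DecidableEq γ] {p : Ω → ℝ} {f : Ω → β} {g : Ω → γ} (w : γ → ℝ) (K : γ → β → ℝ)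
    (hK : ∀ c, ∑ b, K c b = 1)
    (hfg : ∀ b c, distOf p (fun ω => (f ω, g ω)) (b, c) = w c * K c b) :
    condEnt p f g = ∑ c, w c * ent (K c) := by
  have hw : distOf p g = w := by
    funext c
    have h : ∑ b, distOf p (fun ω => (f ω, g ω)) (b, c) = w c := by
      simp_rw [hfg, ← Finset.mul_sum, hK, mul_one]
    rw [← h]
    simp only [distOf]
    rw [Finset.sum_comm]
    refine Finset.sum_congr rfl fun ω _ => ?_
    by_cases hc : g ω = c <;> simp [hc, Prod.ext_iff]
  simp only [condEnt, entOf, hw, ent_eq_sum_negMulLog]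
  rw [Fintype.sum_prod_type_right]
  simp_rw [hfg, Real.negMulLog_mul, Finset.sum_add_distrib, ← Finset.sum_mul, hK, one_mul,
    ← Finset.mul_sum]
  rw [add_div, add_sub_cancel_left, Finset.sum_div]
  exact Finset.sum_congr rfl fun c _ => mul_div_assoc _ _ _

/-- The average output entropy of a random code of `M` i.i.d. codewords from `p`, with
a uniformly chosen codeword sent over the channel `V`. -/
def codeEnt {α β : Type*} [Fintype α] [Fintype β] (p : α → ℝ) (V : α → β → ℝ) (M : ℕ) : ℝ :=
  ∑ c : Fin M → α, (∏ m, p (c m)) * ent (fun y => (M : ℝ)⁻¹ * ∑ m, V (c m) y)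

theorem ent_mixture_le {α β : Type*} [Fintype β] {V : α → β → ℝ} {M : ℕ}
    (hV : ∀ a, IsPMF (V a)) (hM : 0 < M) (c : Fin M → α) :
    ent (fun y => (M : ℝ)⁻¹ * ∑ m, V (c m) y) ≤
      Real.logb 2 M + (M : ℝ)⁻¹ * ∑ m, ent (V (c m)) := by
  have hM' : (0 : ℝ) < M := by exact_mod_cast hM
  have hpt : ∀ y m, -((M : ℝ)⁻¹ * V (c m) y * Real.logb 2 ((M : ℝ)⁻¹ * ∑ m, V (c m) y)) ≤
      (M : ℝ)⁻¹ * V (c m) y * Real.logb 2 M +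
        (M : ℝ)⁻¹ * -(V (c m) y * Real.logb 2 (V (c m) y)) := by
    intro y m
    rcases ((hV (c m)).1 y).eq_or_lt with h0 | h0
    · simp [← h0]
    · have hle : (M : ℝ)⁻¹ * V (c m) y ≤ (M : ℝ)⁻¹ * ∑ m, V (c m) y := by
        refine mul_le_mul_of_nonneg_left ?_ (by positivity)
        exact Finset.single_le_sum (f := fun m => V (c m) y) (fun m _ => (hV (c m)).1 y)
          (Finset.mem_univ m)
      have hlog := Real.logb_le_logb_of_le (b := 2) (by norm_num) (by positivity) hle
      rw [Real.logb_mul (by positivity) h0.ne', Real.logb_inv] at hlog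
      have := mul_le_mul_of_nonneg_left hlog (show 0 ≤ (M : ℝ)⁻¹ * V (c m) y by positivity)
      linarith
  calc ent (fun y => (M : ℝ)⁻¹ * ∑ m, V (c m) y)
      = ∑ y, ∑ m, -((M : ℝ)⁻¹ * V (c m) y * Real.logb 2 ((M : ℝ)⁻¹ * ∑ m, V (c m) y)) := by
        simp only [ent]
        rw [← Finset.sum_neg_distrib]
        refine Finset.sum_congr rfl fun y _ => ?_
        rw [Finset.sum_neg_distrib, ← Finset.sum_mul, ← Finset.mul_sum]
    _ ≤ ∑ y, ∑ m, ((M : ℝ)⁻¹ * V (c m) y * Real.logb 2 M +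
          (M : ℝ)⁻¹ * -(V (c m) y * Real.logb 2 (V (c m) y))) :=
        Finset.sum_le_sum fun y _ => Finset.sum_le_sum fun m _ => hpt y m
    _ = _ := by
        rw [Finset.sum_comm]
        simp_rw [Finset.sum_add_distrib, ← Finset.sum_mul, ← Finset.mul_sum, (hV _).2]
        simp [ent, hM'.ne']

section OneShot

variable {α β : Type*} [Fintype α] [Fintype β] {p : α → ℝ} {V : α → β → ℝ} {M : ℕ}

theorem codeEnt_le_logb_add (hp : IsPMF p) (hV : ∀ a, IsPMF (V a)) (hM : 0 < M) :
    codeEnt p V M ≤ Real.logb 2 M + ∑ a, p a * ent (V a) := by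
  have hM' : (0 : ℝ) < M := by exact_mod_cast hM
  calc codeEnt p V M ≤ ∑ c : Fin M → α, (∏ m, p (c m)) *
        (Real.logb 2 M + (M : ℝ)⁻¹ * ∑ m, ent (V (c m))) :=
        Finset.sum_le_sum fun c _ => mul_le_mul_of_nonneg_left (ent_mixture_le hV hM c)
          (Finset.prod_nonneg fun m _ => hp.1 _)
    _ = _ := by
        have h := sum_pi_mul_sum hp M (fun a => ent (V a))
        have h1 : ∀ c : Fin M → α, (∏ m, p (c m)) *
            (Real.logb 2 M + (M : ℝ)⁻¹ * ∑ m, ent (V (c m))) =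
            (∏ m, p (c m)) * Real.logb 2 M +
              (M : ℝ)⁻¹ * ((∏ m, p (c m)) * ∑ m, ent (V (c m))) := fun c => by ring
        simp_rw [h1]
        rw [Finset.sum_add_distrib, ← Finset.sum_mul, ← Finset.mul_sum, h,
          (isPMF_pi (fun _ : Fin M => hp)).2, one_mul, inv_mul_cancel_left₀ hM'.ne']

theorem codeEnt_le_ent_output (hp : IsPMF p) (hV : ∀ a, IsPMF (V a)) (hM : 0 < M) :
    codeEnt p V M ≤ ent (fun y => ∑ a, p a * V a y) := by
  have hM' : (0 : ℝ) < M := by exact_mod_cast hM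
  simp only [codeEnt, ent_eq_sum_negMulLog, ← mul_div_assoc, ← Finset.sum_div, Finset.mul_sum]
  refine div_le_div_of_nonneg_right ?_ (Real.log_nonneg (by norm_num))
  rw [Finset.sum_comm]
  refine Finset.sum_le_sum fun y _ => ?_
  have hpi := isPMF_pi (fun _ : Fin M => hp)
  have h := Real.concaveOn_negMulLog.le_map_sum (t := Finset.univ)
    (w := fun c : Fin M → α => ∏ m, p (c m)) (p := fun c => (M : ℝ)⁻¹ * ∑ m, V (c m) y)
    (fun c _ => hpi.1 c) hpi.2
    (fun c _ => mul_nonneg (by positivity) (Finset.sum_nonneg fun m _ => (hV _).1 y))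
  simp only [smul_eq_mul] at h
  have hmean : ∑ c : Fin M → α, (∏ m, p (c m)) * ((M : ℝ)⁻¹ * ∑ m, V (c m) y) =
      ∑ a, p a * V a y := by
    simp_rw [mul_left_comm _ (M : ℝ)⁻¹, ← Finset.mul_sum]
    rw [sum_pi_mul_sum hp M (fun a => V a y), inv_mul_cancel_left₀ hM'.ne']
  rw [hmean] at h
  simpa [Finset.mul_sum] using h

/-- Jensen's inequality over all the codewords other than the sent one, `m`. -/
theorem sum_neg_logb_le_of_sent (hp : IsPMF p) {v : α → ℝ} (hv : ∀ a, 0 ≤ v a) (m : Fin M) :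
    ∑ a, p a * (v a * -Real.logb 2 ((M : ℝ)⁻¹ * v a + ∑ b, p b * v b)) ≤
      ∑ c : Fin M → α, (∏ k, p (c k)) *
        (v (c m) * -Real.logb 2 ((M : ℝ)⁻¹ * ∑ k, v (c k))) := by
  have hM' : (0 : ℝ) < M := by exact_mod_cast m.pos
  have hlog2 : 0 < Real.log 2 := Real.log_pos (by norm_num)
  set P := ∑ b, p b * v b with hP
  have hP0 : 0 ≤ P := Finset.sum_nonneg fun a _ => mul_nonneg (hp.1 a) (hv a)
  set D : α → ℝ := fun a => (M : ℝ)⁻¹ * v a + P with hD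
  have hD0 : ∀ a, 0 ≤ D a := fun a => add_nonneg (mul_nonneg (by positivity) (hv a)) hP0
  set h : α → ℝ := fun a => v a / (D a * Real.log 2) with hh
  have hh0 : ∀ a, 0 ≤ h a := fun a => div_nonneg (hv a) (mul_nonneg (hD0 a) hlog2.le)
  have hpt : ∀ c : Fin M → α, v (c m) * -Real.logb 2 (D (c m)) -
      (h (c m) * ∑ k ∈ Finset.univ.erase m, (M : ℝ)⁻¹ * v (c k) - h (c m) * P) ≤
      v (c m) * -Real.logb 2 ((M : ℝ)⁻¹ * ∑ k, v (c k)) := by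
    intro c
    rcases (hv (c m)).eq_or_lt with h0 | h0
    · simp [hh, ← h0]
    · have hsplit : (M : ℝ)⁻¹ * ∑ k, v (c k) =
          (M : ℝ)⁻¹ * v (c m) + ∑ k ∈ Finset.univ.erase m, (M : ℝ)⁻¹ * v (c k) := by
        rw [Finset.mul_sum,
          Finset.add_sum_erase _ (fun k => (M : ℝ)⁻¹ * v (c k)) (Finset.mem_univ m)]
      have hrest : 0 ≤ ∑ k ∈ Finset.univ.erase m, (M : ℝ)⁻¹ * v (c k) :=
        Finset.sum_nonneg fun k _ => mul_nonneg (by positivity) (hv _)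
      have hT : 0 < (M : ℝ)⁻¹ * ∑ k, v (c k) := by rw [hsplit]; positivity
      have hDpos : 0 < D (c m) := by simp only [hD]; positivity
      have hle := Real.log_le_sub_one_of_pos (div_pos hT hDpos)
      rw [Real.log_div hT.ne' hDpos.ne'] at hle
      have hle2 := mul_le_mul_of_nonneg_left hle (div_nonneg h0.le hlog2.le)
      have hid : v (c m) / Real.log 2 * ((M : ℝ)⁻¹ * (∑ k, v (c k)) / D (c m) - 1) =
          h (c m) * ∑ k ∈ Finset.univ.erase m, (M : ℝ)⁻¹ * v (c k) - h (c m) * P := by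
        have hDe : (M : ℝ)⁻¹ * (∑ k, v (c k)) =
            D (c m) + (∑ k ∈ Finset.univ.erase m, (M : ℝ)⁻¹ * v (c k) - P) := by
          rw [hsplit]; simp only [hD]; ring
        rw [hDe]
        simp only [hh]
        field_simp
        ring
      rw [hid] at hle2
      have hid2 : v (c m) / Real.log 2 *
          (Real.log ((M : ℝ)⁻¹ * ∑ k, v (c k)) - Real.log (D (c m))) =
          v (c m) * -Real.logb 2 (D (c m)) -
            v (c m) * -Real.logb 2 ((M : ℝ)⁻¹ * ∑ k, v (c k)) := by
        simp only [Real.logb]; ring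
      linarith
  have hmean : ∑ c : Fin M → α, (∏ k, p (c k)) *
      (h (c m) * ∑ k ∈ Finset.univ.erase m, (M : ℝ)⁻¹ * v (c k)) ≤
      (∑ a, p a * h a) * P := by
    have hE : 0 ≤ (∑ a, p a * h a) * P :=
      mul_nonneg (Finset.sum_nonneg fun a _ => mul_nonneg (hp.1 a) (hh0 a)) hP0
    have hk : ∀ k ∈ Finset.univ.erase m, ∑ c : Fin M → α, (∏ k, p (c k)) *
        (h (c m) * ((M : ℝ)⁻¹ * v (c k))) = (M : ℝ)⁻¹ * ((∑ a, p a * h a) * P) := by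
      intro k hk
      rw [hP, ← sum_pi_mul_eval_mul_eval (fun _ : Fin M => hp) (Finset.ne_of_mem_erase hk).symm h v,
        Finset.mul_sum]
      exact Finset.sum_congr rfl fun c _ => by ring
    simp_rw [Finset.mul_sum]
    rw [Finset.sum_comm, Finset.sum_congr rfl hk, Finset.sum_const, nsmul_eq_mul, ← mul_assoc]
    refine mul_le_of_le_one_left hE ?_
    rw [← div_eq_mul_inv, div_le_one hM']
    exact_mod_cast (Finset.card_le_univ _).trans_eq (Fintype.card_fin M)
  calc ∑ a, p a * (v a * -Real.logb 2 (D a))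
      ≤ ∑ a, p a * (v a * -Real.logb 2 (D a)) -
        (∑ c : Fin M → α, (∏ k, p (c k)) *
          (h (c m) * ∑ k ∈ Finset.univ.erase m, (M : ℝ)⁻¹ * v (c k)) -
          (∑ a, p a * h a) * P) := by linarith
    _ = ∑ c : Fin M → α, (∏ k, p (c k)) * (v (c m) * -Real.logb 2 (D (c m)) -
        (h (c m) * ∑ k ∈ Finset.univ.erase m, (M : ℝ)⁻¹ * v (c k) - h (c m) * P)) := by
        rw [← sum_pi_mul_eval (fun _ : Fin M => hp) m (fun a => v a * -Real.logb 2 (D a)),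
          ← sum_pi_mul_eval (fun _ : Fin M => hp) m h]
        simp only [mul_sub, Finset.sum_sub_distrib, Finset.sum_mul, mul_assoc]
    _ ≤ _ := Finset.sum_le_sum fun c _ => mul_le_mul_of_nonneg_left (hpt c)
        (Finset.prod_nonneg fun k _ => hp.1 _)

/-- The soft-covering lower bound on the output entropy of a random code. -/
theorem sum_neg_logb_le_codeEnt (hp : IsPMF p) (hV : ∀ a, IsPMF (V a)) (hM : 0 < M) :
    ∑ a, p a * ∑ y, V a y * -Real.logb 2 ((M : ℝ)⁻¹ * V a y + ∑ b, p b * V b y) ≤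
      codeEnt p V M := by
  have hM' : (0 : ℝ) < M := by exact_mod_cast hM
  have hcode : codeEnt p V M = ∑ y, (M : ℝ)⁻¹ * ∑ m : Fin M, ∑ c : Fin M → α, (∏ k, p (c k)) *
      (V (c m) y * -Real.logb 2 ((M : ℝ)⁻¹ * ∑ k, V (c k) y)) := by
    have hc : ∀ y, (M : ℝ)⁻¹ * ∑ m : Fin M, ∑ c : Fin M → α, (∏ k, p (c k)) *
        (V (c m) y * -Real.logb 2 ((M : ℝ)⁻¹ * ∑ k, V (c k) y)) =
        ∑ c : Fin M → α, (∏ k, p (c k)) * -((M : ℝ)⁻¹ * (∑ m, V (c m) y) *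
          Real.logb 2 ((M : ℝ)⁻¹ * ∑ k, V (c k) y)) := by
      intro y
      rw [Finset.sum_comm, Finset.mul_sum]
      refine Finset.sum_congr rfl fun c _ => ?_
      rw [← Finset.mul_sum, ← Finset.sum_mul]
      ring
    simp_rw [hc]
    rw [Finset.sum_comm]
    simp only [codeEnt, ent, ← Finset.mul_sum, Finset.sum_neg_distrib]
  rw [hcode]
  simp_rw [Finset.mul_sum (s := (Finset.univ : Finset β))]
  rw [Finset.sum_comm]
  refine Finset.sum_le_sum fun y _ => ?_
  have h := Finset.sum_le_sum fun (m : Fin M) (_ : m ∈ Finset.univ) =>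
    sum_neg_logb_le_of_sent hp (v := fun a => V a y) (fun a => (hV a).1 y) m
  rw [Finset.sum_const, Finset.card_univ, Fintype.card_fin, nsmul_eq_mul] at h
  exact (le_inv_mul_iff₀ hM').2 h

theorem neg_one_add_sum_min_le_codeEnt (hp : IsPMF p) (hV : ∀ a, IsPMF (V a)) (hM : 0 < M) :
    -1 + ∑ a, p a * ∑ y, V a y * min (Real.logb 2 M - Real.logb 2 (V a y))
      (-Real.logb 2 (∑ b, p b * V b y)) ≤ codeEnt p V M := by
  have hM' : (0 : ℝ) < M := by exact_mod_cast hM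
  refine le_trans ?_ (sum_neg_logb_le_codeEnt hp hV hM)
  have hone : (-1 : ℝ) = ∑ a, p a * ∑ y, V a y * -1 := by
    simp_rw [← Finset.sum_mul, (hV _).2, one_mul, ← Finset.sum_mul, hp.2, one_mul]
  rw [hone, ← Finset.sum_add_distrib]
  refine Finset.sum_le_sum fun a _ => ?_
  rcases (hp.1 a).eq_or_lt with ha | ha
  · simp [← ha]
  rw [← mul_add, ← Finset.sum_add_distrib]
  refine mul_le_mul_of_nonneg_left (Finset.sum_le_sum fun y _ => ?_) ha.le
  rcases ((hV a).1 y).eq_or_lt with hy | hy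
  · simp [← hy]
  rw [← mul_add]
  refine mul_le_mul_of_nonneg_left ?_ hy.le
  set P := ∑ b, p b * V b y with hP
  have hPpos : 0 < P := lt_of_lt_of_le (mul_pos ha hy)
    (Finset.single_le_sum (f := fun b => p b * V b y)
      (fun b _ => mul_nonneg (hp.1 b) ((hV b).1 y)) (Finset.mem_univ a))
  have hv : 0 < (M : ℝ)⁻¹ * V a y := by positivity
  have hlogv : Real.logb 2 ((M : ℝ)⁻¹ * V a y) = Real.logb 2 (V a y) - Real.logb 2 M := by
    rw [Real.logb_mul (by positivity) hy.ne', Real.logb_inv]; ring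
  have hlog2 : ∀ t : ℝ, 0 < t → Real.logb 2 (2 * t) = 1 + Real.logb 2 t := fun t ht => by
    rw [Real.logb_mul (by norm_num) ht.ne', Real.logb_self_eq_one (by norm_num)]
  rcases le_total ((M : ℝ)⁻¹ * V a y) P with hle | hle
  · have h := Real.logb_le_logb_of_le (b := 2) (by norm_num) (add_pos hv hPpos)
      (show (M : ℝ)⁻¹ * V a y + P ≤ 2 * P by linarith)
    rw [hlog2 P hPpos] at h
    have := min_le_right (Real.logb 2 M - Real.logb 2 (V a y)) (-Real.logb 2 P)
    linarith
  · have h := Real.logb_le_logb_of_le (b := 2) (by norm_num) (add_pos hv hPpos)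
      (show (M : ℝ)⁻¹ * V a y + P ≤ 2 * ((M : ℝ)⁻¹ * V a y) by linarith)
    rw [hlog2 _ hv, hlogv] at h
    have := min_le_left (Real.logb 2 M - Real.logb 2 (V a y)) (-Real.logb 2 P)
    linarith

end OneShot

section Block

variable {S α β : Type*}

/-- The joint law of state, input and output. -/
def stateJoint (pS : S → ℝ) (pX : S → α → ℝ) (V : S → α → β → ℝ) : S × α × β → ℝ :=
  fun z => pS z.1 * pX z.1 z.2.1 * V z.1 z.2.1 z.2.2

/-- The output law given the state. -/
def stateOut [Fintype α] (pX : S → α → ℝ) (V : S → α → β → ℝ) (s : S) (y : β) : ℝ :=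
  ∑ x, pX s x * V s x y

variable {pS : S → ℝ} {pX : S → α → ℝ} {V : S → α → β → ℝ}

theorem channel_ne_zero_of_stateJoint {z : S × α × β} (hz : stateJoint pS pX V z ≠ 0) :
    V z.1 z.2.1 z.2.2 ≠ 0 := right_ne_zero_of_mul hz

theorem sum_pi_mul_channel [Fintype α] (n : ℕ) (s : Fin n → S) (y : Fin n → β) :
    ∑ x : Fin n → α, (∏ i, pX (s i) (x i)) * ∏ i, V (s i) (x i) (y i) =
      ∏ i, stateOut pX V (s i) (y i) := by
  simp_rw [← Finset.prod_mul_distrib]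
  exact sum_prod_pi fun i x => pX (s i) x * V (s i) x (y i)

theorem stateOut_ne_zero_of_stateJoint [Fintype α] [Fintype β] (hX : ∀ s, IsPMF (pX s))
    (hV : ∀ s x, IsPMF (V s x)) {z : S × α × β} (hz : stateJoint pS pX V z ≠ 0) :
    stateOut pX V z.1 z.2.2 ≠ 0 := by
  have hx : 0 < pX z.1 z.2.1 :=
    lt_of_le_of_ne ((hX _).1 _) (right_ne_zero_of_mul (left_ne_zero_of_mul hz)).symm
  have hv : 0 < V z.1 z.2.1 z.2.2 :=
    lt_of_le_of_ne ((hV _ _).1 _) (right_ne_zero_of_mul hz).symm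
  exact (lt_of_lt_of_le (mul_pos hx hv) (Finset.single_le_sum
    (f := fun x => pX z.1 x * V z.1 x z.2.2)
    (fun x _ => mul_nonneg ((hX _).1 x) ((hV _ x).1 _)) (Finset.mem_univ z.2.1))).ne'

variable [Fintype S] [Fintype α] [Fintype β]

/-- The `n`-letter average of `codeEnt` when the code distribution and the channel depend on
an i.i.d. state sequence. -/
def blockEnt (pS : S → ℝ) (pX : S → α → ℝ) (V : S → α → β → ℝ) (n M : ℕ) : ℝ :=
  ∑ s : Fin n → S, (∏ i, pS (s i)) *
    codeEnt (fun x : Fin n → α => ∏ i, pX (s i) (x i))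
      (fun x (y : Fin n → β) => ∏ i, V (s i) (x i) (y i)) M

theorem isPMF_stateJoint (hS : IsPMF pS) (hX : ∀ s, IsPMF (pX s)) (hV : ∀ s x, IsPMF (V s x)) :
    IsPMF (stateJoint pS pX V) := by
  refine ⟨fun z => mul_nonneg (mul_nonneg (hS.1 _) ((hX _).1 _)) ((hV _ _).1 _), ?_⟩
  simp only [stateJoint, Fintype.sum_prod_type, ← Finset.mul_sum, (hV _ _).2, (hX _).2, hS.2,
    mul_one]

theorem sum_stateJoint_pi (n : ℕ) (F : (Fin n → S) → (Fin n → α) → (Fin n → β) → ℝ) :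
    ∑ z : Fin n → S × α × β, (∏ i, stateJoint pS pX V (z i)) *
        F (fun i => (z i).1) (fun i => (z i).2.1) (fun i => (z i).2.2) =
      ∑ s : Fin n → S, (∏ i, pS (s i)) * ∑ x : Fin n → α, (∏ i, pX (s i) (x i)) *
        ∑ y : Fin n → β, (∏ i, V (s i) (x i) (y i)) * F s x y := by
  rw [sum_pi_prod]
  simp_rw [sum_pi_prod (α := α) (β := β), stateJoint, Finset.prod_mul_distrib, Finset.mul_sum,
    mul_assoc]

/-- The letterwise decomposition of the log-likelihood holds on the support of the law. -/
theorem logb_prod_of_support {Z : Type*} {r v : Z → ℝ} (hrv : ∀ z, r z ≠ 0 → v z ≠ 0) {n : ℕ}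
    {z : Fin n → Z} (hz : ∏ i, r (z i) ≠ 0) :
    -Real.logb 2 (∏ i, v (z i)) = ∑ i, -Real.logb 2 (v (z i)) := by
  rw [Real.logb_prod, Finset.sum_neg_distrib]
  exact fun i hi => hrv _ (Finset.prod_ne_zero_iff.1 hz i hi)

theorem sum_pi_mul_neg_logb {Z : Type*} [Fintype Z] {r v : Z → ℝ} (hr : IsPMF r)
    (hrv : ∀ z, r z ≠ 0 → v z ≠ 0) (n : ℕ) :
    ∑ z : Fin n → Z, (∏ i, r (z i)) * -Real.logb 2 (∏ i, v (z i)) =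
      n * ∑ z, r z * -Real.logb 2 (v z) := by
  rw [← sum_pi_mul_sum hr n (fun z => -Real.logb 2 (v z))]
  refine Finset.sum_congr rfl fun z _ => ?_
  by_cases hz : ∏ i, r (z i) = 0
  · simp [hz]
  · rw [logb_prod_of_support hrv hz]

theorem ent_eq_sum_neg_logb {Z : Type*} [Fintype Z] (p : Z → ℝ) :
    ent p = ∑ z, p z * -Real.logb 2 (p z) := by
  simp [ent]

theorem blockEnt_le_logb_add (hS : IsPMF pS) (hX : ∀ s, IsPMF (pX s))
    (hV : ∀ s x, IsPMF (V s x)) (n : ℕ) {M : ℕ} (hM : 0 < M) :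
    blockEnt pS pX V n M ≤ Real.logb 2 M +
      n * ∑ z, stateJoint pS pX V z * -Real.logb 2 (V z.1 z.2.1 z.2.2) := by
  have hpi := isPMF_pi (fun _ : Fin n => hS)
  rw [← sum_pi_mul_neg_logb (v := fun z : S × α × β => V z.1 z.2.1 z.2.2)
    (isPMF_stateJoint hS hX hV) (fun z => channel_ne_zero_of_stateJoint),
    sum_stateJoint_pi n (fun s x y => -Real.logb 2 (∏ i, V (s i) (x i) (y i)))]
  calc blockEnt pS pX V n M ≤ ∑ s : Fin n → S, (∏ i, pS (s i)) * (Real.logb 2 M +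
        ∑ x : Fin n → α, (∏ i, pX (s i) (x i)) *
          ent (fun y : Fin n → β => ∏ i, V (s i) (x i) (y i))) :=
        Finset.sum_le_sum fun s _ => mul_le_mul_of_nonneg_left
          (codeEnt_le_logb_add (isPMF_pi fun i => hX (s i))
            (fun x => isPMF_pi fun i => hV (s i) (x i)) hM) (hpi.1 s)
    _ = _ := by
        simp_rw [mul_add, Finset.sum_add_distrib, ← Finset.sum_mul, hpi.2, one_mul,
          ent_eq_sum_neg_logb]

theorem blockEnt_le_output (hS : IsPMF pS) (hX : ∀ s, IsPMF (pX s))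
    (hV : ∀ s x, IsPMF (V s x)) (n : ℕ) {M : ℕ} (hM : 0 < M) :
    blockEnt pS pX V n M ≤
      n * ∑ z, stateJoint pS pX V z * -Real.logb 2 (stateOut pX V z.1 z.2.2) := by
  have hpi := isPMF_pi (fun _ : Fin n => hS)
  rw [← sum_pi_mul_neg_logb (v := fun z : S × α × β => stateOut pX V z.1 z.2.2)
    (isPMF_stateJoint hS hX hV) (fun z => stateOut_ne_zero_of_stateJoint hX hV),
    sum_stateJoint_pi n (fun s x y => -Real.logb 2 (∏ i, stateOut pX V (s i) (y i)))]
  refine Finset.sum_le_sum fun s _ => mul_le_mul_of_nonneg_left ?_ (hpi.1 s)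
  refine (codeEnt_le_ent_output (isPMF_pi fun i => hX (s i))
    (fun x => isPMF_pi fun i => hV (s i) (x i)) hM).trans_eq ?_
  simp_rw [sum_pi_mul_channel, ent_eq_sum_neg_logb, Finset.mul_sum]
  rw [Finset.sum_comm]
  refine Finset.sum_congr rfl fun y _ => ?_
  rw [← sum_pi_mul_channel, Finset.sum_mul]
  exact Finset.sum_congr rfl fun x _ => mul_assoc _ _ _

theorem le_blockEnt (hS : IsPMF pS) (hX : ∀ s, IsPMF (pX s))
    (hV : ∀ s x, IsPMF (V s x)) : ∃ C : ℝ, ∀ n M : ℕ, 0 < n → 0 < M →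
    min (Real.logb 2 M + n * ∑ z, stateJoint pS pX V z * -Real.logb 2 (V z.1 z.2.1 z.2.2))
      (n * ∑ z, stateJoint pS pX V z * -Real.logb 2 (stateOut pX V z.1 z.2.2)) - 1 - √n * C ≤
      blockEnt pS pX V n M := by
  have hr := isPMF_stateJoint hS hX hV
  set r := stateJoint pS pX V with hrdef
  set fA : S × α × β → ℝ := fun z => -Real.logb 2 (V z.1 z.2.1 z.2.2) with hfA
  set fB : S × α × β → ℝ := fun z => -Real.logb 2 (stateOut pX V z.1 z.2.2) with hfB
  refine ⟨(∑ z, r z * (fA z - ∑ b, r b * fA b) ^ 2 + 1) / 2 +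
    (∑ z, r z * (fB z - ∑ b, r b * fB b) ^ 2 + 1) / 2, fun n M hn hM => ?_⟩
  have hpi := isPMF_pi (fun _ : Fin n => hS)
  have hrpi := isPMF_pi (fun _ : Fin n => hr)
  have hdevA := sum_pi_mul_abs_sub_le hr hn fA
  have hdevB := sum_pi_mul_abs_sub_le hr hn fB
  set a := ∑ z, r z * fA z with ha
  set b := ∑ z, r z * fB z with hb
  have hcode : -1 + ∑ z : Fin n → S × α × β, (∏ i, r (z i)) *
      min (Real.logb 2 M + ∑ i, fA (z i)) (∑ i, fB (z i)) ≤ blockEnt pS pX V n M := by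
    have hlow : ∑ s : Fin n → S, (∏ i, pS (s i)) * (-1 +
        ∑ x : Fin n → α, (∏ i, pX (s i) (x i)) * ∑ y : Fin n → β, (∏ i, V (s i) (x i) (y i)) *
          min (Real.logb 2 M - Real.logb 2 (∏ i, V (s i) (x i) (y i)))
            (-Real.logb 2 (∏ i, stateOut pX V (s i) (y i)))) ≤ blockEnt pS pX V n M := by
      refine Finset.sum_le_sum fun s _ => mul_le_mul_of_nonneg_left ?_ (hpi.1 s)
      simp_rw [← sum_pi_mul_channel]
      exact neg_one_add_sum_min_le_codeEnt (isPMF_pi fun i => hX (s i))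
        (fun x => isPMF_pi fun i => hV (s i) (x i)) hM
    refine le_trans (le_of_eq ?_) hlow
    simp_rw [mul_add, Finset.sum_add_distrib, ← Finset.sum_mul, hpi.2, one_mul]
    rw [← sum_stateJoint_pi n (fun s x y =>
      min (Real.logb 2 M - Real.logb 2 (∏ i, V (s i) (x i) (y i)))
        (-Real.logb 2 (∏ i, stateOut pX V (s i) (y i))))]
    congr 1
    refine Finset.sum_congr rfl fun z _ => ?_
    by_cases hz : ∏ i, r (z i) = 0
    · rw [hz, zero_mul, zero_mul]
    · have h1 := logb_prod_of_support (v := fun z : S × α × β => V z.1 z.2.1 z.2.2)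
        (fun z => channel_ne_zero_of_stateJoint) hz
      have h2 := logb_prod_of_support (v := fun z : S × α × β => stateOut pX V z.1 z.2.2)
        (fun z => stateOut_ne_zero_of_stateJoint hX hV) hz
      rw [h2, sub_eq_add_neg, h1]
  have hmin : ∀ u v u' v' : ℝ, min u v - |u' - u| - |v' - v| ≤ min u' v' := by
    intro u v u' v'
    refine le_min ?_ ?_
    · linarith [min_le_left u v, neg_abs_le (u' - u), abs_nonneg (v' - v)]
    · linarith [min_le_right u v, neg_abs_le (v' - v), abs_nonneg (u' - u)]
  have hsum : ∑ z : Fin n → S × α × β, (∏ i, r (z i)) *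
      (min (Real.logb 2 M + n * a) (n * b) - |∑ i, fA (z i) - n * a| -
        |∑ i, fB (z i) - n * b|) ≤ ∑ z : Fin n → S × α × β, (∏ i, r (z i)) *
      min (Real.logb 2 M + ∑ i, fA (z i)) (∑ i, fB (z i)) := by
    refine Finset.sum_le_sum fun z _ => mul_le_mul_of_nonneg_left ?_ (hrpi.1 z)
    simpa using hmin (Real.logb 2 M + n * a) (n * b) (Real.logb 2 M + ∑ i, fA (z i))
      (∑ i, fB (z i))
  simp_rw [mul_sub, Finset.sum_sub_distrib, ← Finset.sum_mul, hrpi.2, one_mul] at hsum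
  linarith

theorem logb_msgSize_le (n : ℕ) {R : ℝ} (hR : 0 ≤ R) : Real.logb 2 (msgSize n R) ≤ n * R := by
  have h1 : (1 : ℝ) ≤ 2 ^ ((n : ℝ) * R) :=
    Real.one_le_rpow (by norm_num) (mul_nonneg (Nat.cast_nonneg n) hR)
  have hpos : (0 : ℝ) < msgSize n R := Nat.cast_pos.2 (NeZero.pos _)
  rw [Real.logb_le_iff_le_rpow (by norm_num) hpos, msgSize, Nat.cast_max, Nat.cast_one]
  exact max_le h1 (Nat.floor_le (by positivity))

theorem le_logb_msgSize (n : ℕ) (R : ℝ) : n * R - 1 ≤ Real.logb 2 (msgSize n R) := by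
  have hpos : (0 : ℝ) < msgSize n R := Nat.cast_pos.2 (NeZero.pos _)
  rw [Real.le_logb_iff_rpow_le (by norm_num) hpos, Real.rpow_sub_one (by norm_num), msgSize,
    Nat.cast_max, Nat.cast_one]
  have h := Nat.lt_floor_add_one ((2 : ℝ) ^ ((n : ℝ) * R))
  rcases le_total ((2 : ℝ) ^ ((n : ℝ) * R)) 2 with h2 | h2
  · exact le_max_of_le_left (by linarith)
  · exact le_max_of_le_right (by linarith)

theorem tendsto_blockEnt (hS : IsPMF pS) (hX : ∀ s, IsPMF (pX s))
    (hV : ∀ s x, IsPMF (V s x)) {R : ℝ} (hR : 0 ≤ R) :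
    Tendsto (fun n : ℕ => (n : ℝ)⁻¹ * blockEnt pS pX V n (msgSize n R)) atTop
      (nhds (min (R + ∑ z, stateJoint pS pX V z * -Real.logb 2 (V z.1 z.2.1 z.2.2))
        (∑ z, stateJoint pS pX V z * -Real.logb 2 (stateOut pX V z.1 z.2.2)))) := by
  obtain ⟨C, hC⟩ := le_blockEnt hS hX hV
  have hup1 := fun n => blockEnt_le_logb_add hS hX hV n (NeZero.pos (msgSize n R))
  have hup2 := fun n => blockEnt_le_output hS hX hV n (NeZero.pos (msgSize n R))
  set a := ∑ z, stateJoint pS pX V z * -Real.logb 2 (V z.1 z.2.1 z.2.2)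
  set b := ∑ z, stateJoint pS pX V z * -Real.logb 2 (stateOut pX V z.1 z.2.2)
  have hlim : Tendsto (fun n : ℕ => min (R + a) b - 2 * (n : ℝ)⁻¹ - (√(n : ℝ))⁻¹ * C) atTop
      (nhds (min (R + a) b)) := by
    have h1 : Tendsto (fun n : ℕ => (n : ℝ)⁻¹) atTop (nhds 0) := tendsto_inv_atTop_nhds_zero_nat
    have h2 : Tendsto (fun n : ℕ => (√(n : ℝ))⁻¹) atTop (nhds 0) :=
      tendsto_inv_atTop_zero.comp (Real.tendsto_sqrt_atTop.comp tendsto_natCast_atTop_atTop)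
    simpa using (tendsto_const_nhds.sub (h1.const_mul 2)).sub (h2.mul_const C)
  refine tendsto_of_tendsto_of_tendsto_of_le_of_le' hlim tendsto_const_nhds ?_ ?_
  · filter_upwards [eventually_gt_atTop 0] with n hn
    have hn' : (0 : ℝ) < n := by exact_mod_cast hn
    have hs : 0 < √(n : ℝ) := Real.sqrt_pos.2 hn'
    have hss : √(n : ℝ) * √(n : ℝ) = n := Real.mul_self_sqrt hn'.le
    rw [le_inv_mul_iff₀ hn']
    refine le_trans ?_ (hC n (msgSize n R) hn (NeZero.pos _))
    have hmin : n * min (R + a) b - 1 ≤ min (Real.logb 2 (msgSize n R) + n * a) (n * b) := by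
      refine le_min ?_ ?_
      · have := mul_le_mul_of_nonneg_left (min_le_left (R + a) b) hn'.le
        linarith [le_logb_msgSize n R]
      · have := mul_le_mul_of_nonneg_left (min_le_right (R + a) b) hn'.le
        linarith
    have hexp : n * (min (R + a) b - 2 * (n : ℝ)⁻¹ - (√(n : ℝ))⁻¹ * C) =
        n * min (R + a) b - 2 - √n * C := by
      have : (n : ℝ) * (√(n : ℝ))⁻¹ = √n := by
        nth_rewrite 1 [← hss]; field_simp
      rw [mul_sub, mul_sub, ← mul_assoc _ _ C, this]
      field_simp
    linarith
  · filter_upwards [eventually_gt_atTop 0] with n hn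
    have hn' : (0 : ℝ) < n := by exact_mod_cast hn
    rw [inv_mul_le_iff₀ hn', mul_min_of_nonneg _ _ hn'.le]
    exact le_min (by linarith [hup1 n, logb_msgSize_le n hR]) (hup2 n)

end Block

theorem entOf_comp_equiv {Ω β γ : Type*} [Fintype Ω] [Fintype β] [Fintype γ] [DecidableEq β]
    [DecidableEq γ] (p : Ω → ℝ) (f : Ω → β) (e : β ≃ γ) :
    entOf p (fun ω => e (f ω)) = entOf p f := by
  simp only [entOf, ent, distOf]
  rw [← e.sum_comp]
  simp

/-- `I(f; g | h) = H(g | h) - H(g | f, h)`, with the conditioning variables in any order. -/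
theorem condMutInfo_eq_condEnt_sub {Ω β γ δ δ' : Type*} [Fintype Ω] [Fintype β] [Fintype γ]
    [Fintype δ] [Fintype δ'] [DecidableEq β] [DecidableEq γ] [DecidableEq δ] [DecidableEq δ']
    (p : Ω → ℝ) (f : Ω → β) (g : Ω → γ) (h : Ω → δ) (e : β × δ ≃ δ') :
    condMutInfo p f g h = condEnt p g h - condEnt p g (fun ω => e (f ω, h ω)) := by
  have h1 := entOf_comp_equiv p (fun ω => (f ω, h ω)) e
  have h2 := entOf_comp_equiv p (fun ω => (f ω, g ω, h ω))
    ((Equiv.prodAssoc β γ δ).symm.trans (((Equiv.prodComm β γ).prodCongr (Equiv.refl δ)).trans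
      ((Equiv.prodAssoc γ β δ).trans ((Equiv.refl γ).prodCongr e))))
  simp only [Equiv.trans_apply, Equiv.prodAssoc_symm_apply, Equiv.prodCongr_apply, Prod.map,
    Equiv.prodComm_apply, Prod.swap_prod_mk, Equiv.refl_apply, Equiv.prodAssoc_apply] at h2
  simp only [condMutInfo, condEnt, h1, h2]
  ring

/-- The law of the pair `(Q, X1)`. -/
def sideP (s : Q × X1) : ℝ := pQ s.1 * pX1 s.1 s.2

/-- The channel from `X2` to `Y1` given `(Q, X1)`. -/
def sideChannel (s : Q × X1) (x2 : X2) (y : Y1) : ℝ := ∑ y2, W s.2 x2 (y, y2)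

section Reduction

set_option linter.unusedSectionVars false

variable {pQ pX1 pX2 W}

theorem isPMF_sideP {σ τ : Type*} [Fintype σ] [Fintype τ] {pQ : σ → ℝ} {pX1 : σ → τ → ℝ}
    (hpQ : IsPMF pQ) (hpX1 : ∀ q, IsPMF (pX1 q)) :
    IsPMF (sideP pQ pX1) := by
  refine ⟨fun s => mul_nonneg (hpQ.1 _) ((hpX1 _).1 _), ?_⟩
  simp only [sideP, Fintype.sum_prod_type, ← Finset.mul_sum, (hpX1 _).2, hpQ.2, mul_one]

theorem isPMF_sideChannel {σ τ α β γ : Type*} [Fintype β] [Fintype γ] {W : τ → α → β × γ → ℝ}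
    (hW : ∀ x1 x2, IsPMF (W x1 x2)) (s : σ × τ) (x2 : α) :
    IsPMF (sideChannel W s x2) := by
  refine ⟨fun y => Finset.sum_nonneg fun y2 _ => (hW _ _).1 _, ?_⟩
  simp only [sideChannel]
  rw [← Fintype.sum_prod_type, (hW s.2 x2).2]

theorem condEnt_jointP_inputs (hW : ∀ x1 x2, IsPMF (W x1 x2)) :
    condEnt (jointP pQ pX1 pX2 W) vY1 (fun z => (vX1 z, vX2 z, vQ z)) =
      ∑ z, stateJoint (sideP pQ pX1) (fun s => pX2 s.1) (sideChannel W) z *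
        -Real.logb 2 (sideChannel W z.1 z.2.1 z.2.2) := by
  rw [condEnt_eq_of_kernel
    (fun c : X1 × X2 × Q => pQ c.2.2 * pX1 c.2.2 c.1 * pX2 c.2.2 c.2.1)
    (fun c y => sideChannel W (c.2.2, c.1) c.2.1 y)
    (fun c => (isPMF_sideChannel hW (c.2.2, c.1) c.2.1).2)]
  · simp only [ent_eq_sum_neg_logb, Fintype.sum_prod_type, Finset.mul_sum, stateJoint, sideP,
      mul_assoc]
    rw [Finset.sum_comm_cycle]
  · rintro y ⟨x1, x2, q⟩
    simp only [distOf, jointP, vY1, vX1, vX2, vQ, Fintype.sum_prod_type, Prod.mk.injEq, sideChannel,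
      Finset.mul_sum, ite_and]
    simp

theorem condEnt_jointP_side (hpX2 : ∀ q, IsPMF (pX2 q)) (hW : ∀ x1 x2, IsPMF (W x1 x2)) :
    condEnt (jointP pQ pX1 pX2 W) vY1 (fun z => (vX1 z, vQ z)) =
      ∑ z, stateJoint (sideP pQ pX1) (fun s => pX2 s.1) (sideChannel W) z *
        -Real.logb 2 (stateOut (fun s => pX2 s.1) (sideChannel W) z.1 z.2.2) := by
  rw [condEnt_eq_of_kernel
    (fun c : X1 × Q => pQ c.2 * pX1 c.2 c.1)
    (fun c y => stateOut (fun s : Q × X1 => pX2 s.1) (sideChannel W) (c.2, c.1) y)]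
  · simp only [ent_eq_sum_neg_logb, Fintype.sum_prod_type, stateJoint, sideP]
    rw [Finset.sum_comm]
    refine Finset.sum_congr rfl fun q _ => Finset.sum_congr rfl fun x1 _ => ?_
    rw [Finset.sum_comm, Finset.mul_sum]
    refine Finset.sum_congr rfl fun y _ => ?_
    rw [← Finset.sum_mul, ← mul_assoc]
    congr 1
    rw [stateOut, Finset.mul_sum]
    exact Finset.sum_congr rfl fun x2 _ => (mul_assoc _ _ _).symm
  · rintro ⟨x1, q⟩
    simp only [stateOut]
    rw [Finset.sum_comm]
    simp_rw [← Finset.mul_sum, (isPMF_sideChannel hW _ _).2, mul_one]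
    exact (hpX2 q).2
  · rintro y ⟨x1, q⟩
    simp only [distOf, jointP, vY1, vX1, vQ, Fintype.sum_prod_type, Prod.mk.injEq, sideChannel,
      stateOut, Finset.mul_sum, ite_and]
    simp [mul_assoc]

/-- The conditional law of `Y1^n` given `X1^n = x1` and the codebook `c`. -/
def codebookChannel {n M1 M2 : ℕ} (W : X1 → X2 → Y1 × Y2 → ℝ)
    (g : (Fin n → X1) × Codebook Q X1 X2 n M1 M2) (y : Fin n → Y1) : ℝ :=
  (M2 : ℝ)⁻¹ * ∑ m2, ∏ i, sideChannel W (g.2.1 i, g.1 i) (g.2.2.2 m2 i) (y i)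

theorem sum_codebookChannel {σ τ α β γ : Type*} [Fintype β] [Fintype γ] {W : τ → α → β × γ → ℝ}
    (hW : ∀ x1 x2, IsPMF (W x1 x2)) {n M1 M2 : ℕ} (hM2 : 0 < M2)
    (g : (Fin n → τ) × Codebook σ τ α n M1 M2) : ∑ y, codebookChannel W g y = 1 := by
  have hM : (M2 : ℝ) ≠ 0 := by exact_mod_cast hM2.ne'
  simp only [codebookChannel]
  rw [← Finset.mul_sum, Finset.sum_comm]
  simp_rw [(isPMF_pi fun i => isPMF_sideChannel hW (g.2.1 i, g.1 i) (g.2.2.2 _ i)).2]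
  simp [hM]

theorem distOf_expP {n M1 M2 : ℕ} (y : Fin n → Y1) (x1 : Fin n → X1)
    (c : Codebook Q X1 X2 n M1 M2) :
    distOf (expP pQ pX1 pX2 W (n := n) (M1 := M1) (M2 := M2))
        (fun ω => (ω.2.2.2.1, (ω.1.2.1 ω.2.1, ω.1))) (y, (x1, c)) =
      (ensembleP pQ pX1 pX2 c * ((M1 : ℝ)⁻¹ * ∑ m1, if c.2.1 m1 = x1 then 1 else 0)) *
        codebookChannel W (x1, c) y := by
  have hy2 : ∀ (m2 : Fin M2), ∑ y2 : Fin n → Y2, ∏ i, W (x1 i) (c.2.2 m2 i) (y i, y2 i) =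
      ∏ i, sideChannel W (c.1 i, x1 i) (c.2.2 m2 i) (y i) := fun m2 =>
    sum_prod_pi fun i y2 => W (x1 i) (c.2.2 m2 i) (y i, y2)
  simp only [distOf]
  rw [Fintype.sum_prod_type, Finset.sum_eq_single c]
  · have hterm : ∀ (m1 : Fin M1) (m2 : Fin M2),
        ∑ y' : Fin n → Y1, ∑ y2 : Fin n → Y2,
          (if (y', (c.2.1 m1, c)) = (y, (x1, c)) then
            expP pQ pX1 pX2 W (c, m1, m2, y', y2) else 0) =
        ∑ y2 : Fin n → Y2, (if c.2.1 m1 = x1 then 1 else 0) *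
          (ensembleP pQ pX1 pX2 c * ((M1 : ℝ) * M2)⁻¹ *
            ∏ i, W (x1 i) (c.2.2 m2 i) (y i, y2 i)) := by
      intro m1 m2
      rw [Finset.sum_eq_single y]
      · refine Finset.sum_congr rfl fun y2 _ => ?_
        by_cases h : c.2.1 m1 = x1 <;> simp [h, expP]
      · intro y' _ hy'
        simp [hy']
      · simp
    simp only [Fintype.sum_prod_type, hterm, codebookChannel]
    simp_rw [← Finset.mul_sum, hy2, ← Finset.sum_mul]
    rw [mul_inv]
    ring
  · intro c' _ hc'
    exact Finset.sum_eq_zero fun ω _ => by simp [hc']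
  · simp

theorem condEnt_expP (hpX1 : ∀ q, IsPMF (pX1 q)) (hW : ∀ x1 x2, IsPMF (W x1 x2))
    {n M1 M2 : ℕ} (hM1 : 0 < M1) (hM2 : 0 < M2) :
    condEnt (expP pQ pX1 pX2 W (n := n) (M1 := M1) (M2 := M2))
        (fun ω => ω.2.2.2.1) (fun ω => (ω.1.2.1 ω.2.1, ω.1)) =
      blockEnt (sideP pQ pX1) (fun s => pX2 s.1) (sideChannel W) n M2 := by
  have hM : (M1 : ℝ) ≠ 0 := by exact_mod_cast hM1.ne'
  rw [condEnt_eq_of_kernel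
    (fun g => ensembleP pQ pX1 pX2 g.2 * ((M1 : ℝ)⁻¹ * ∑ m1, if g.2.2.1 m1 = g.1 then 1 else 0))
    (codebookChannel W) (sum_codebookChannel hW hM2) (fun y g => distOf_expP y g.1 g.2)]
  set E : (Fin n → Q) → (Fin n → X1) → ℝ := fun q x1 =>
    codeEnt (fun x : Fin n → X2 => ∏ i, pX2 (q i) (x i))
      (fun x (y : Fin n → Y1) => ∏ i, sideChannel W (q i, x1 i) (x i) (y i)) M2 with hE
  have hblock : blockEnt (sideP pQ pX1) (fun s => pX2 s.1) (sideChannel W) n M2 =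
      ∑ q : Fin n → Q, (∏ i, pQ (q i)) * ∑ x1 : Fin n → X1, (∏ i, pX1 (q i) (x1 i)) * E q x1 := by
    simp only [blockEnt]
    rw [sum_pi_prod]
    simp only [sideP, Finset.prod_mul_distrib, Finset.mul_sum, mul_assoc, hE]
  rw [hblock, Fintype.sum_prod_type_right, Fintype.sum_prod_type]
  refine Finset.sum_congr rfl fun q _ => ?_
  have hmarg := sum_pi_mul_sum (isPMF_pi fun i => hpX1 (q i)) M1 (E q)
  rw [← inv_mul_cancel_left₀ hM (∑ x1 : Fin n → X1, (∏ i, pX1 (q i) (x1 i)) * E q x1), ← hmarg,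
    Fintype.sum_prod_type, Finset.mul_sum, Finset.mul_sum]
  refine Finset.sum_congr rfl fun c1 _ => ?_
  have hx1 : ∀ (t : ℝ) (F : (Fin n → X1) → ℝ),
      ∑ x1, t * ((M1 : ℝ)⁻¹ * ∑ m1, if c1 m1 = x1 then 1 else 0) * F x1 =
        t * ((M1 : ℝ)⁻¹ * ∑ m1, F (c1 m1)) := by
    intro t F
    simp_rw [mul_assoc, ← Finset.mul_sum, Finset.sum_mul]
    rw [Finset.sum_comm]
    simp
  simp only [hx1]
  have hEc : ∀ x1, E q x1 = ∑ c2 : Fin M2 → Fin n → X2, (∏ m, ∏ i, pX2 (q i) (c2 m i)) *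
      ent (codebookChannel W (x1, (q, c1, c2))) := fun _ => rfl
  simp only [hEc, ensembleP, Finset.mul_sum]
  rw [Finset.sum_comm]
  refine Finset.sum_congr rfl fun m1 _ => Finset.sum_congr rfl fun c2 _ => ?_
  ring

end Reduction

/-- **Lemma 1.** For the `(2^{nR1}, 2^{nR2}, n; p)` random code ensemble used over the
2-DM-IC, `(1/n) H(Y1^n | X1^n, C_n) → H(Y1 | X1, X2, Q) + min{R2, I(X2; Y1 | X1, Q)}`,
where `C_n` is the random codebook, `X1^n = X1^n(M1)` is the transmitted codeword of
sender 1, and `Y1^n` is the output at receiver 1. -/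
theorem conditional_output_entropy_limit
    (hpQ : IsPMF pQ) (hpX1 : ∀ q, IsPMF (pX1 q)) (hpX2 : ∀ q, IsPMF (pX2 q))
    (hW : ∀ x1 x2, IsPMF (W x1 x2)) (R1 R2 : ℝ) (hR1 : 0 ≤ R1) (hR2 : 0 ≤ R2) :
    Tendsto (fun n : ℕ => ((n : ℝ))⁻¹ *
        condEnt (expP pQ pX1 pX2 W (n := n) (M1 := msgSize n R1) (M2 := msgSize n R2))
          (fun ω => ω.2.2.2.1) (fun ω => (ω.1.2.1 ω.2.1, ω.1)))
      atTop
      (nhds (condEnt (jointP pQ pX1 pX2 W) vY1 (fun z => (vX1 z, vX2 z, vQ z)) +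
        min R2 (condMutInfo (jointP pQ pX1 pX2 W) vX2 vY1 (fun z => (vX1 z, vQ z))))) := by
  have hmain := tendsto_blockEnt (isPMF_sideP hpQ hpX1) (fun s => hpX2 s.1)
    (isPMF_sideChannel hW) hR2
  simp_rw [condEnt_expP hpX1 hW (NeZero.pos (msgSize _ R1)) (NeZero.pos (msgSize _ R2))]
  have hI := condMutInfo_eq_condEnt_sub (jointP pQ pX1 pX2 W) vX2 vY1 (fun z => (vX1 z, vQ z))
    ((Equiv.prodAssoc X2 X1 Q).symm.trans (((Equiv.prodComm X2 X1).prodCongr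
      (Equiv.refl Q)).trans (Equiv.prodAssoc X1 X2 Q)))
  simp only [Equiv.trans_apply, Equiv.prodAssoc_symm_apply, Equiv.prodCongr_apply, Prod.map,
    Equiv.prodComm_apply, Prod.swap_prod_mk, Equiv.refl_apply, Equiv.prodAssoc_apply] at hI
  rw [hI, ← min_add_add_left, add_sub_cancel, add_comm _ R2, condEnt_jointP_inputs hW,
    condEnt_jointP_side hpX2 hW]
  exact hmain

end TwoUser
end
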